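/- The linear map A ↦ A⋄Φ₀ is injective on the 43-dimensional subspace of endomorphisms of ℝ⁸ of the form h + X, where h is self-adjoint and X is skew-adjoint with associated 2-form α_X(x,y) = ⟨Xx,y⟩ lying in Λ²₇ = ker(M − 3·id); consequently the image of the map A ↦ A⋄Φ₀ is a 43-dimensional subspace of the space of alternating 4-forms on ℝ⁸. -/

import Mathlib

open scoped TensorProduct
open Matrix

noncomputable section

/-- `ℝ⁸` with its standard basis. -/
abbrev V : Type := Fin 8 → ℝ

/-- Alternating `k`-forms on `ℝ⁸`. -/
abbrev Form (k : ℕ) : Type := V [⋀^Fin k]→ₗ[ℝ] ℝ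

/-- Standard basis vector `eᵢ` of `ℝ⁸`. -/
def e (i : Fin 8) : V := Pi.single i 1

/-- The elementary 4-form `eⁱ∧eʲ∧eᵏ∧eˡ` (determinant convention). -/
def E4 (i j k l : Fin 8) : Form 4 :=
  (Matrix.detRowAlternating : (Fin 4 → ℝ) [⋀^Fin 4]→ₗ[ℝ] ℝ).compLinearMap
    (LinearMap.funLeft ℝ ℝ ![i, j, k, l])

/-- The Cayley 4-form `Φ₀` on `ℝ⁸` (indices shifted from `1,…,8` to `0,…,7`):
`Φ₀ = e^{1234}+e^{1256}+e^{1278}+e^{1357}−e^{1368}−e^{1458}−e^{1467}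
      +e^{5678}+e^{3478}+e^{3456}+e^{2468}−e^{2457}−e^{2367}−e^{2358}`. -/
def Φ₀ : Form 4 :=
  E4 0 1 2 3 + E4 0 1 4 5 + E4 0 1 6 7 + E4 0 2 4 6 - E4 0 2 5 7 - E4 0 3 4 7 - E4 0 3 5 6
    + E4 4 5 6 7 + E4 2 3 6 7 + E4 2 3 4 5 + E4 1 3 5 7 - E4 1 3 4 6 - E4 1 2 5 6 - E4 1 2 4 7

/-- The standard volume form `e¹∧e²∧⋯∧e⁸` of `ℝ⁸`. -/
def vol₀ : Form 8 := Matrix.detRowAlternating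

/-- The wedge product of alternating forms (shuffle convention, so that
`(e¹∧e²)(e₁,e₂) = 1`). -/
def wedge {k l : ℕ} (α : Form k) (β : Form l) : Form (k + l) :=
  AlternatingMap.domDomCongr finSumFinEquiv
    ((LinearMap.mul' ℝ ℝ).compAlternatingMap (AlternatingMap.domCoprod α β))

/-- The double contraction `v ⌟ w ⌟ Φ`, i.e. the alternating 2-form
`(x, y) ↦ Φ (w, v, x, y)`. -/
def contr (v w : V) (Φ : Form 4) : Form 2 :=
  AlternatingMap.curryLeft (AlternatingMap.curryLeft Φ w) v

/-- The inner product on alternating `k`-forms on `ℝ⁸` making the forms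
`e^{i₁}∧⋯∧e^{i_k}` with `i₁<⋯<i_k` an orthonormal basis. -/
def formInner {k : ℕ} (α β : Form k) : ℝ :=
  ∑ s : Finset (Fin 8),
    if h : s.card = k then
      α (fun a => e ((s.orderIsoOfFin h a : Fin 8))) *
        β (fun a => e ((s.orderIsoOfFin h a : Fin 8)))
    else 0

/-- A 4-form `Ψ` on `ℝ⁸` is admissible (a `Spin(7)`-form) if `Ψ = g*Φ₀` for some
`g ∈ GL(8,ℝ)`, where `(g*Φ₀)(x,y,z,w) = Φ₀(gx,gy,gz,gw)`. -/
def Admissible (Ψ : Form 4) : Prop :=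
  ∃ g : V →ₗ[ℝ] V, Function.Bijective g ∧ Ψ = Φ₀.compLinearMap g

/-- The elementary form `e^{v₀}∧⋯∧e^{vₙ₋₁}`. -/
def mon {n : ℕ} (v : Fin n → Fin 8) : Form n :=
  (Matrix.detRowAlternating : (Fin n → ℝ) [⋀^Fin n]→ₗ[ℝ] ℝ).compLinearMap
    (LinearMap.funLeft ℝ ℝ v)

theorem mon_apply {n : ℕ} (v : Fin n → Fin 8) (x : Fin n → V) :
    mon v x = Matrix.det (Matrix.of fun a b => x a (v b)) := rfl

theorem mon_eq_alternatization {n : ℕ} (v : Fin n → Fin 8) :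
    mon v = MultilinearMap.alternatization
      ((MultilinearMap.mkPiAlgebra ℝ (Fin n) ℝ).compLinearMap
        fun a => (LinearMap.proj (v a) : V →ₗ[ℝ] ℝ)) := by
  ext x
  simp [mon_apply, Matrix.det_apply, MultilinearMap.alternatization_apply]

theorem wedge_mon {k l : ℕ} (v : Fin k → Fin 8) (w : Fin l → Fin 8) :
    wedge (mon v) (mon w) = mon (Fin.append v w) := by
  ext x
  rw [wedge, mon_eq_alternatization v, mon_eq_alternatization w,
    ← MultilinearMap.domCoprod_alternization, ← LinearMap.compMultilinearMap_alternatization,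
    mon_apply, ← Matrix.det_submatrix_equiv_self finSumFinEquiv, Matrix.det_apply]
  simp [MultilinearMap.alternatization_apply, Function.comp_def]

theorem wedge_add_left {k l : ℕ} (α α' : Form k) (β : Form l) :
    wedge (α + α') β = wedge α β + wedge α' β := by
  ext x
  simp only [wedge, ← AlternatingMap.domCoprod'_apply, TensorProduct.add_tmul, map_add]
  simp

theorem wedge_smul_left {k l : ℕ} (c : ℝ) (α : Form k) (β : Form l) :
    wedge (c • α) β = c • wedge α β := by
  ext x
  simp only [wedge, ← AlternatingMap.domCoprod'_apply, ← TensorProduct.smul_tmul', map_smul]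
  simp

theorem wedge_add_right {k l : ℕ} (α : Form k) (β β' : Form l) :
    wedge α (β + β') = wedge α β + wedge α β' := by
  ext x
  simp only [wedge, ← AlternatingMap.domCoprod'_apply, TensorProduct.tmul_add, map_add]
  simp

theorem wedge_smul_right {k l : ℕ} (c : ℝ) (α : Form k) (β : Form l) :
    wedge α (c • β) = c • wedge α β := by
  ext x
  simp only [wedge, ← AlternatingMap.domCoprod'_apply, TensorProduct.tmul_smul, map_smul]
  simp

/-- The wedge product as a bilinear map. -/
def wedgeₗ (k l : ℕ) : Form k →ₗ[ℝ] Form l →ₗ[ℝ] Form (k + l) :=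
  LinearMap.mk₂ ℝ wedge wedge_add_left wedge_smul_left wedge_add_right wedge_smul_right

/-- The signs with `Φ₀ (e i, e j, e k, e l) = W i j * W k l` when `{i, j}` and `{k, l}` are
disjoint pairs with `i xor j = k xor l`. -/
def W : Fin 8 → Fin 8 → ℤ :=
  ![![1, 1, 1, 1, 1, 1, 1, 1], ![-1, 1, 1, -1, 1, -1, 1, -1], ![-1, -1, 1, 1, 1, -1, -1, 1],
    ![-1, 1, -1, 1, -1, -1, 1, 1], ![-1, -1, -1, 1, 1, 1, 1, -1], ![-1, 1, 1, 1, -1, 1, -1, -1],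
    ![-1, -1, 1, -1, -1, 1, 1, 1], ![-1, 1, -1, -1, 1, 1, -1, 1]]

/-- The components of `Φ₀` in the standard basis. -/
def φ (i j k l : Fin 8) : ℤ :=
  if i ≠ j ∧ i ^^^ j = k ^^^ l ∧ i ≠ k ∧ i ≠ l then W i j * W k l else 0

theorem form_apply_update {n : ℕ} (F : Form n) (v : Fin n → V) (r : Fin n) (x : V) :
    F (Function.update v r x) = ∑ m, x m * F (Function.update v r (e m)) := by
  have := LinearMap.pi_apply_eq_sum_univ (F.toMultilinearMap.toLinearMap v r) x
  simp only [MultilinearMap.toLinearMap_apply, AlternatingMap.coe_multilinearMap,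
    smul_eq_mul] at this
  rw [this]
  refine Finset.sum_congr rfl fun m _ => ?_
  congr 3
  ext j
  simp [e, Pi.single_apply, eq_comm]

theorem form_ext {n : ℕ} {F G : Form n}
    (h : ∀ v : Fin n → Fin 8, StrictMono v → F (fun a => e (v a)) = G (fun a => e (v a))) :
    F = G := by
  refine Module.Basis.ext_alternating (Pi.basisFun ℝ (Fin 8)) fun v hv => ?_
  have hs : StrictMono (v ∘ Tuple.sort v) :=
    (Tuple.monotone_sort v).strictMono_of_injective (hv.comp (Equiv.injective _))
  have := h _ hs
  have key : ∀ H : Form n, H (fun a => e ((v ∘ Tuple.sort v) a)) =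
      Equiv.Perm.sign (Tuple.sort v) • H (fun a => Pi.basisFun ℝ (Fin 8) (v a)) := by
    intro H
    rw [← AlternatingMap.map_perm]
    simp [e, Function.comp_def]
  rw [key, key] at this
  exact smul_left_cancel _ this

theorem mon_apply_e {n : ℕ} (v w : Fin n → Fin 8) (hv : StrictMono v) (hw : StrictMono w) :
    mon v (fun a => e (w a)) = if v = w then 1 else 0 := by
  rw [mon_apply]
  split_ifs with h
  · subst h
    rw [← Matrix.det_one (n := Fin n)]
    congr 1
    ext a b
    simp [e, Pi.single_apply, Matrix.one_apply, hv.injective.eq_iff, eq_comm]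
  · obtain ⟨a, ha⟩ : ∃ a, w a ∉ Set.range v := by
      by_contra! hc
      apply h
      have hr : Set.range w ⊆ Set.range v := by
        rintro _ ⟨a, rfl⟩
        exact hc a
      have : Set.range v = Set.range w := by
        symm
        apply Set.eq_of_subset_of_ncard_le hr
        simp [Set.ncard_range_of_injective, hv.injective, hw.injective]
      exact (hv.range_inj hw).1 this
    apply Matrix.det_eq_zero_of_row_eq_zero a
    intro b
    have : v b ≠ w a := fun hb => ha ⟨b, hb⟩
    simp [e, this]

theorem mon_two (i j : Fin 8) (x y : V) : mon ![i, j] ![x, y] = x i * y j - x j * y i := by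
  simp [mon_apply, Matrix.det_fin_two]

/-- Integer components of `eᵏ∧eˡ`. -/
def d2 (a b i j : Fin 8) : ℤ :=
  (if i = a ∧ j = b then 1 else 0) - (if i = b ∧ j = a then 1 else 0)

/-- Integer components of an elementary 3-form. -/
def d3 (a b c i j k : Fin 8) : ℤ :=
  (if i = a then d2 b c j k else 0) - (if i = b then d2 a c j k else 0) +
    (if i = c then d2 a b j k else 0)

/-- Integer components of an elementary 4-form. -/
def d4 (a b c d i j k l : Fin 8) : ℤ :=
  (if i = a then d3 b c d j k l else 0) - (if i = b then d3 a c d j k l else 0) +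
    (if i = c then d3 a b d j k l else 0) - (if i = d then d3 a b c j k l else 0)

theorem E4_apply_e (a b c d i j k l : Fin 8) :
    E4 a b c d ![e i, e j, e k, e l] = d4 a b c d i j k l := by
  have h2 : ∀ a b i j : Fin 8, ((d2 a b i j : ℤ) : ℝ) = e i a * e j b - e i b * e j a := by
    intro a b i j
    simp [d2, e, Pi.single_apply, ← ite_and, eq_comm, and_comm]
  change Matrix.det (Matrix.of fun r s => ![e i, e j, e k, e l] r (![a, b, c, d] s)) = _
  have h3 : ∀ a b c i j k : Fin 8, ((d3 a b c i j k : ℤ) : ℝ) =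
      e i a * d2 b c j k - e i b * d2 a c j k + e i c * d2 a b j k := by
    intro a b c i j k
    simp [d3, e, Pi.single_apply, eq_comm]
  have h4 : ((d4 a b c d i j k l : ℤ) : ℝ) =
      e i a * d3 b c d j k l - e i b * d3 a c d j k l + e i c * d3 a b d j k l
        - e i d * d3 a b c j k l := by
    simp [d4, e, Pi.single_apply, eq_comm]
  rw [h4]
  simp only [h3, h2]
  simp [Matrix.det_succ_row_zero, Fin.sum_univ_succ, Fin.succAbove]
  ring

set_option maxRecDepth 100000 in
theorem d4_sum_eq_φ : ∀ i j k l : Fin 8,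
    d4 0 1 2 3 i j k l + d4 0 1 4 5 i j k l + d4 0 1 6 7 i j k l + d4 0 2 4 6 i j k l
    - d4 0 2 5 7 i j k l - d4 0 3 4 7 i j k l - d4 0 3 5 6 i j k l + d4 4 5 6 7 i j k l
    + d4 2 3 6 7 i j k l + d4 2 3 4 5 i j k l + d4 1 3 5 7 i j k l - d4 1 3 4 6 i j k l
    - d4 1 2 5 6 i j k l - d4 1 2 4 7 i j k l = φ i j k l := by
  decide +kernel

theorem Φ₀_apply_e (i j k l : Fin 8) : Φ₀ ![e i, e j, e k, e l] = φ i j k l := by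
  rw [← d4_sum_eq_φ]
  simp only [Φ₀, AlternatingMap.add_apply, AlternatingMap.sub_apply, E4_apply_e]
  push_cast
  rfl

theorem E4_eq_mon (a b c d : Fin 8) : E4 a b c d = mon ![a, b, c, d] := rfl

theorem wedgeₗ_apply {k l : ℕ} (α : Form k) (β : Form l) : wedgeₗ k l α β = wedge α β := rfl

theorem append_inl {k l : ℕ} (v : Fin k → Fin 8) (w : Fin l → Fin 8) (a : Fin k) :
    Fin.append v w (finSumFinEquiv (Sum.inl a)) = v a := by
  rw [finSumFinEquiv_apply_left, Fin.append_left]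

theorem append_inr {k l : ℕ} (v : Fin k → Fin 8) (w : Fin l → Fin 8) (a : Fin l) :
    Fin.append v w (finSumFinEquiv (Sum.inr a)) = w a := by
  rw [finSumFinEquiv_apply_right, Fin.append_right]

/-- The coefficient of a form of top degree with respect to `vol₀`. -/
def topCoeff {n : ℕ} (hn : n = 8) : Form n →ₗ[ℝ] ℝ where
  toFun F := F fun i => e (Fin.cast hn i)
  map_add' _ _ := rfl
  map_smul' _ _ := rfl

theorem topCoeff_apply {n : ℕ} (hn : n = 8) (F : Form n) :
    topCoeff hn F = F fun i => e (Fin.cast hn i) := rfl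

theorem topCoeff_mon_append {k l : ℕ} (hn : k + l = 8) (q u : Fin k → Fin 8) (w : Fin l → Fin 8)
    (f : Equiv.Perm (Fin (k + l))) (hf : ∀ a, Fin.cast hn (f a) = Fin.append q w a) :
    topCoeff hn (mon (Fin.append u w)) =
      (Equiv.Perm.sign f : ℤ) * mon q (fun a => e (u a)) := by
  have hinj : ∀ a b, Fin.append q w (finSumFinEquiv a) = Fin.append q w (finSumFinEquiv b) →
      a = b := by
    intro a b h
    rw [← hf, ← hf] at h
    exact finSumFinEquiv.injective (f.injective (Fin.cast_injective hn h))
  rw [topCoeff_apply, mon_apply, mon_apply]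
  have h1 := Matrix.det_permute f
    (Matrix.of fun a b : Fin (k + l) => e (Fin.cast hn a) (Fin.append u w b))
  have h2 : (Matrix.of fun a b : Fin (k + l) => e (Fin.cast hn a) (Fin.append u w b)).submatrix f id =
      (Matrix.fromBlocks (Matrix.of fun a b => e (u a) (q b))ᵀ 0
        (Matrix.of fun a b => e (w a) (u b)) 1).submatrix
          finSumFinEquiv.symm finSumFinEquiv.symm := by
    ext a b
    obtain ⟨a, rfl⟩ := finSumFinEquiv.surjective a
    obtain ⟨b, rfl⟩ := finSumFinEquiv.surjective b
    simp only [Matrix.submatrix_apply, Matrix.of_apply, id, hf, Equiv.symm_apply_apply]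
    rcases a with a | a <;> rcases b with b | b
    · simp only [append_inl]
      simp [e, Pi.single_apply, eq_comm]
    · have : w b ≠ q a := fun h => by
        simpa using hinj (Sum.inr b) (Sum.inl a) (by rw [append_inl, append_inr, h])
      simp only [append_inl, append_inr]
      simp [e, this]
    · simp only [append_inl, append_inr]
      simp
    · have : w b = w a ↔ a = b := by
        refine ⟨fun h => ?_, fun h => by rw [h]⟩
        simpa using hinj (Sum.inr a) (Sum.inr b) (by rw [append_inr, append_inr, h])
      simp only [append_inr]
      simp [e, Pi.single_apply, Matrix.one_apply, this]
  rw [h2, Matrix.det_submatrix_equiv_self, Matrix.det_fromBlocks_zero₁₂, Matrix.det_transpose,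
    Matrix.det_one, mul_one] at h1
  rw [h1, ← mul_assoc, ← Int.cast_mul]
  simp

/-- The Hodge dual of `e^w` is `e^q` when `(q, w)` is an even permutation of the indices. -/
theorem topCoeff_wedge_mon {k l : ℕ} (hn : k + l = 8) (u q : Fin k → Fin 8) (w : Fin l → Fin 8)
    (hinj : ∀ i j, Fin.append q w i = Fin.append q w j → i = j)
    (hs : ∏ j, ∏ i ∈ Finset.Iio j,
      (if Fin.append q w i < Fin.append q w j then 1 else -1 : ℤˣ) = 1) :
    topCoeff hn (wedge (mon u) (mon w)) = mon q (fun i => e (u i)) := by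
  let f : Equiv.Perm (Fin (k + l)) :=
    Equiv.ofBijective (fun i => Fin.cast hn.symm (Fin.append q w i))
      (Finite.injective_iff_bijective.1 fun i j h => hinj i j (Fin.cast_injective _ h))
  have hsign : Equiv.Perm.sign f = 1 := by
    rw [Equiv.Perm.sign_eq_prod_prod_Iio]
    exact hs
  rw [wedge_mon, topCoeff_mon_append hn q u w f (fun i => by simp [f]), hsign]
  simp

theorem topCoeff_wedge_mon_Φ₀ {n : ℕ} (hn : n = 4) (u : Fin n → Fin 8) :
    topCoeff (by rw [hn]) (wedge (mon u) Φ₀) = Φ₀ (fun i => e (u (Fin.cast hn.symm i))) := by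
  subst hn
  have h (w q : Fin 4 → Fin 8) (hi) (hs) :
      topCoeff (n := 4 + 4) rfl (wedgeₗ 4 4 (mon u) (mon w)) = mon q (fun i => e (u i)) :=
    topCoeff_wedge_mon (k := 4) (l := 4) rfl u q w hi hs
  simp only [← wedgeₗ_apply, Φ₀, E4_eq_mon, map_add, map_sub, AlternatingMap.add_apply,
    AlternatingMap.sub_apply, Fin.cast_eq_self]
  rw [h ![0, 1, 2, 3] ![4, 5, 6, 7] (by decide +kernel) (by decide +kernel),
    h ![0, 1, 4, 5] ![2, 3, 6, 7] (by decide +kernel) (by decide +kernel),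
    h ![0, 1, 6, 7] ![2, 3, 4, 5] (by decide +kernel) (by decide +kernel),
    h ![0, 2, 4, 6] ![1, 3, 5, 7] (by decide +kernel) (by decide +kernel),
    h ![0, 2, 5, 7] ![1, 3, 4, 6] (by decide +kernel) (by decide +kernel),
    h ![0, 3, 4, 7] ![1, 2, 5, 6] (by decide +kernel) (by decide +kernel),
    h ![0, 3, 5, 6] ![1, 2, 4, 7] (by decide +kernel) (by decide +kernel),
    h ![4, 5, 6, 7] ![0, 1, 2, 3] (by decide +kernel) (by decide +kernel),
    h ![2, 3, 6, 7] ![0, 1, 4, 5] (by decide +kernel) (by decide +kernel),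
    h ![2, 3, 4, 5] ![0, 1, 6, 7] (by decide +kernel) (by decide +kernel),
    h ![1, 3, 5, 7] ![0, 2, 4, 6] (by decide +kernel) (by decide +kernel),
    h ![1, 3, 4, 6] ![0, 2, 5, 7] (by decide +kernel) (by decide +kernel),
    h ![1, 2, 5, 6] ![0, 3, 4, 7] (by decide +kernel) (by decide +kernel),
    h ![1, 2, 4, 7] ![0, 3, 5, 6] (by decide +kernel) (by decide +kernel)]
  ring

theorem topCoeff_heq {n : ℕ} (hn : n = 8) (F : Form n) (G : Form 8) (h : HEq F G) :
    topCoeff hn F = topCoeff rfl G := by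
  subst hn
  rw [eq_of_heq h]

theorem detRowAlternating_apply {n : ℕ} (x : Fin n → Fin n → ℝ) :
    (Matrix.detRowAlternating : (Fin n → ℝ) [⋀^Fin n]→ₗ[ℝ] ℝ) x = Matrix.det (Matrix.of x) := rfl

theorem form_two_eq_sum (α : Form 2) :
    α = (1 / 2 : ℝ) • ∑ i, ∑ j, α ![e i, e j] • mon ![i, j] := by
  refine form_ext fun v _ => ?_
  have hv : (fun a => e (v a)) = ![e (v 0), e (v 1)] := by
    ext a; fin_cases a <;> rfl
  rw [hv]
  have hs : α ![e (v 1), e (v 0)] = - α ![e (v 0), e (v 1)] := by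
    rw [← AlternatingMap.map_swap (i := 0) (j := 1) α _ (by decide)]
    congr 1
    ext a; fin_cases a <;> simp
  let L : Form 2 →ₗ[ℝ] ℝ :=
    { toFun := fun β => β ![e (v 0), e (v 1)], map_add' := fun _ _ => rfl,
      map_smul' := fun _ _ => rfl }
  suffices h : L α = L ((1 / 2 : ℝ) • ∑ i, ∑ j, α ![e i, e j] • mon ![i, j]) from h
  simp only [map_smul, map_sum]
  have hL : ∀ i j, L (mon ![i, j]) =
      (if i = v 0 then 1 else 0) * (if j = v 1 then 1 else 0) -
        (if j = v 0 then 1 else 0) * (if i = v 1 then 1 else 0) := by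
    intro i j
    change mon ![i, j] ![e (v 0), e (v 1)] = _
    simp only [mon_two, e, Pi.single_apply]
  simp only [hL, smul_eq_mul, mul_sub, Finset.sum_sub_distrib, mul_ite, mul_one, mul_zero,
    Finset.sum_ite_eq', Finset.mem_univ, if_true, Finset.sum_ite_irrel, Finset.sum_const_zero]
  rw [hs]
  change α ![e (v 0), e (v 1)] = _
  ring

theorem formInner_mon (γ : Form 2) {k l : Fin 8} (hkl : k < l) :
    formInner γ (mon ![k, l]) = γ ![e k, e l] := by
  have hmono : StrictMono ![k, l] := by
    intro a b hab
    fin_cases a <;> fin_cases b <;> simp_all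
  have hcard : ({k, l} : Finset (Fin 8)).card = 2 := Finset.card_pair hkl.ne
  have hmem : ∀ a, ![k, l] a ∈ ({k, l} : Finset (Fin 8)) := by
    intro a; fin_cases a <;> simp
  have huniq := Finset.orderEmbOfFin_unique hcard hmem hmono
  have hval : ∀ (s : Finset (Fin 8)) (h : s.card = 2),
      mon ![k, l] (fun a => e ((s.orderIsoOfFin h a : Fin 8))) =
        if ![k, l] = s.orderEmbOfFin h then 1 else 0 := by
    intro s h
    exact mon_apply_e _ (s.orderEmbOfFin h) hmono (OrderEmbedding.strictMono _)
  have hval' : (fun a => e ((({k, l} : Finset (Fin 8)).orderIsoOfFin hcard a : Fin 8))) =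
      ![e k, e l] := by
    have : ∀ a, (({k, l} : Finset (Fin 8)).orderIsoOfFin hcard a : Fin 8) = ![k, l] a :=
      fun a => (congrFun huniq a).symm
    ext a
    simp only [this]
    fin_cases a <;> rfl
  rw [formInner, Finset.sum_eq_single {k, l}]
  · rw [dif_pos hcard, hval, if_pos huniq, mul_one, hval']
  · intro s _ hs
    split_ifs with h
    · rw [hval, if_neg, mul_zero]
      intro heq
      apply hs
      rw [← Finset.coe_inj, ← Finset.range_orderEmbOfFin s h, ← heq]
      simp [Set.pair_comm]
    · rfl
  · simp

theorem apply_e_of_wedge_eq {M : Form 2 →ₗ[ℝ] Form 2}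
    (hM : ∀ α β : Form 2, wedge (wedge α β) Φ₀ = formInner (M α) β • vol₀) (α : Form 2)
    {k l : Fin 8} (hkl : k < l) :
    M α ![e k, e l] = 1 / 2 * ∑ i, ∑ j, α ![e i, e j] * φ i j k l := by
  have hvol : topCoeff rfl vol₀ = 1 := by
    rw [topCoeff_apply, vol₀, detRowAlternating_apply, ← Matrix.det_one (n := Fin 8)]
    refine congrArg Matrix.det ?_
    ext i j
    simp [e, Pi.single_apply, Matrix.one_apply, eq_comm]
  have h := topCoeff_heq (n := 2 + 2 + 4) rfl _ _ (heq_of_eq (hM α (mon ![k, l])))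
  rw [map_smul, hvol, formInner_mon _ hkl, smul_eq_mul, mul_one] at h
  have hmon : ∀ i j : Fin 8,
      topCoeff (n := 2 + 2 + 4) rfl (wedge (wedge (mon ![i, j]) (mon ![k, l])) Φ₀) =
        φ i j k l := by
    intro i j
    rw [wedge_mon, topCoeff_wedge_mon_Φ₀ rfl, ← Φ₀_apply_e]
    refine congrArg Φ₀ (funext fun a => ?_)
    fin_cases a <;> rfl
  rw [← h]
  let L : Form 2 →ₗ[ℝ] ℝ :=
    topCoeff (n := 2 + 2 + 4) rfl ∘ₗ (wedgeₗ (2 + 2) 4).flip Φ₀ ∘ₗ (wedgeₗ 2 2).flip (mon ![k, l])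
  have hL : ∀ β, topCoeff (n := 2 + 2 + 4) rfl (wedge (wedge β (mon ![k, l])) Φ₀) = L β :=
    fun β => by simp only [L, LinearMap.comp_apply, LinearMap.flip_apply, wedgeₗ_apply]
  simp only [hL] at hmon ⊢
  conv_lhs => rw [form_two_eq_sum α]
  simp only [map_smul, map_sum, smul_eq_mul]
  refine congrArg (1 / 2 * ·) ?_
  refine Finset.sum_congr rfl fun i _ => Finset.sum_congr rfl fun j _ => ?_
  rw [hmon]

theorem W_mul_self (i j : Fin 8) : (W i j : ℝ) * W i j = 1 := by
  have : ∀ i j, W i j * W i j = 1 := by decide +kernel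
  exact_mod_cast this i j

theorem W_swap {i j : Fin 8} (h : i ≠ j) : (W j i : ℝ) = -W i j := by
  have : ∀ i j, i ≠ j → W j i = -W i j := by decide +kernel
  exact_mod_cast this i j h

theorem xor_xor_left (i j : Fin 8) : i ^^^ (i ^^^ j) = j := by
  revert i j
  decide +kernel

theorem φ_eq : ∀ i j k l : Fin 8, φ i j k l =
    if j = i ^^^ (k ^^^ l) then (if k ≠ l ∧ i ≠ k ∧ i ≠ l then W i j * W k l else 0) else 0 := by
  decide +kernel

/-- The action of `α ↦ ⋆(α ∧ Φ₀)` on components. -/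
theorem sum_mul_φ (B : Fin 8 → Fin 8 → ℝ) (hB : ∀ i j, B j i = -B i j) {k l : Fin 8}
    (hkl : k ≠ l) :
    ∑ i, ∑ j, B i j * φ i j k l =
      W k l * (∑ i, W i (i ^^^ (k ^^^ l)) * B i (i ^^^ (k ^^^ l))) - 2 * B k l := by
  have h : ∀ i, ∑ j, B i j * φ i j k l = W k l * (W i (i ^^^ (k ^^^ l)) * B i (i ^^^ (k ^^^ l)))
      - (if i = k then B k l else 0) - (if i = l then B k l else 0) := by
    intro i
    rw [Finset.sum_eq_single (i ^^^ (k ^^^ l))]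
    · rw [φ_eq, if_pos rfl]
      by_cases hik : i = k
      · subst hik
        rw [xor_xor_left, if_neg (by tauto), if_pos rfl, if_neg hkl, ← mul_assoc, W_mul_self]
        simp
      · by_cases hil : i = l
        · subst hil
          have : i ^^^ (k ^^^ i) = k := by
            revert i k
            decide +kernel
          rw [this, if_neg (by tauto), if_neg hik, if_pos rfl, ← mul_assoc, W_swap hkl, mul_neg,
            W_mul_self, hB k i]
          simp
        · rw [if_pos ⟨hkl, hik, hil⟩, if_neg hik, if_neg hil]
          push_cast
          ring
    · intro j _ hj
      rw [φ_eq, if_neg hj]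
      simp
    · simp
  simp only [h, Finset.sum_sub_distrib, Finset.sum_ite_eq', Finset.mem_univ, if_true,
    ← Finset.mul_sum]
  ring

theorem sum_mul_φ_apply_e (x : V) (f : Fin 8 → ℤ) (m : Fin 8) (h : ∀ j, j ≠ m → f j = 0) :
    ∑ j, x j * (f j : ℝ) = x m * f m := by
  rw [Finset.sum_eq_single m]
  · intro j _ hj
    rw [h j hj]
    simp
  · simp

theorem Φ₀_slot_zero (x : V) (j k l : Fin 8) :
    Φ₀ ![x, e j, e k, e l] = x (j ^^^ k ^^^ l) * φ (j ^^^ k ^^^ l) j k l := by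
  have h := form_apply_update Φ₀ ![0, e j, e k, e l] 0 x
  have hu : ∀ y : V, Function.update ![0, e j, e k, e l] 0 y = ![y, e j, e k, e l] := by
    intro y; ext a; fin_cases a <;> rfl
  simp only [hu, Φ₀_apply_e] at h
  rw [h, sum_mul_φ_apply_e x _ (j ^^^ k ^^^ l)]
  clear h hu
  revert j k l
  decide +kernel

theorem Φ₀_slot_one (x : V) (i k l : Fin 8) :
    Φ₀ ![e i, x, e k, e l] = x (i ^^^ k ^^^ l) * φ i (i ^^^ k ^^^ l) k l := by
  have h := form_apply_update Φ₀ ![e i, 0, e k, e l] 1 x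
  have hu : ∀ y : V, Function.update ![e i, 0, e k, e l] 1 y = ![e i, y, e k, e l] := by
    intro y; ext a; fin_cases a <;> rfl
  simp only [hu, Φ₀_apply_e] at h
  rw [h, sum_mul_φ_apply_e x (fun j => φ i j k l) (i ^^^ k ^^^ l)]
  clear h hu
  revert i k l
  decide +kernel

theorem Φ₀_slot_two (x : V) (i j l : Fin 8) :
    Φ₀ ![e i, e j, x, e l] = x (i ^^^ j ^^^ l) * φ i j (i ^^^ j ^^^ l) l := by
  have h := form_apply_update Φ₀ ![e i, e j, 0, e l] 2 x
  have hu : ∀ y : V, Function.update ![e i, e j, 0, e l] 2 y = ![e i, e j, y, e l] := by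
    intro y; ext a; fin_cases a <;> rfl
  simp only [hu, Φ₀_apply_e] at h
  rw [h, sum_mul_φ_apply_e x (fun k => φ i j k l) (i ^^^ j ^^^ l)]
  clear h hu
  revert i j l
  decide +kernel

theorem Φ₀_slot_three (x : V) (i j k : Fin 8) :
    Φ₀ ![e i, e j, e k, x] = x (i ^^^ j ^^^ k) * φ i j k (i ^^^ j ^^^ k) := by
  have h := form_apply_update Φ₀ ![e i, e j, e k, 0] 3 x
  have hu : ∀ y : V, Function.update ![e i, e j, e k, 0] 3 y = ![e i, e j, e k, y] := by
    intro y; ext a; fin_cases a <;> rfl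
  simp only [hu, Φ₀_apply_e] at h
  rw [h, sum_mul_φ_apply_e x (fun l => φ i j k l) (i ^^^ j ^^^ k)]
  clear h hu
  revert i j k
  decide +kernel

/-- The signed entries of an endomorphism entering the components of `A ⋄ Φ₀`. -/
def signedEntry (A : V →ₗ[ℝ] V) (t i : Fin 8) : ℝ := W (i ^^^ t) i * A (e i) (i ^^^ t)

theorem exists_sign_mul_sum {D : (V →ₗ[ℝ] V) →ₗ[ℝ] Form 4}
    (hD : ∀ (A : V →ₗ[ℝ] V) (x y z w : V),
      D A ![x, y, z, w] =
        Φ₀ ![A x, y, z, w] + Φ₀ ![x, A y, z, w] + Φ₀ ![x, y, A z, w] + Φ₀ ![x, y, z, A w])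
    {i j k l : Fin 8} (hd : [i, j, k, l].Nodup) {t : Fin 8} (ht : t = i ^^^ j ^^^ k ^^^ l) :
    ∃ c : ℝ, c ≠ 0 ∧ ∀ A, D A ![e i, e j, e k, e l] = c * (signedEntry A t i +
      signedEntry A t j + signedEntry A t k + signedEntry A t l) := by
  have hs : ∀ i j k l : Fin 8, [i, j, k, l].Nodup →
      let c := φ (j ^^^ k ^^^ l) j k l * W (j ^^^ k ^^^ l) i
      c ≠ 0 ∧ φ (j ^^^ k ^^^ l) j k l = c * W (j ^^^ k ^^^ l) i ∧
        φ i (i ^^^ k ^^^ l) k l = c * W (i ^^^ k ^^^ l) j ∧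
        φ i j (i ^^^ j ^^^ l) l = c * W (i ^^^ j ^^^ l) k ∧
        φ i j k (i ^^^ j ^^^ k) = c * W (i ^^^ j ^^^ k) l := by
    decide +kernel
  have hx : ∀ i j k l : Fin 8, i ^^^ (i ^^^ j ^^^ k ^^^ l) = j ^^^ k ^^^ l ∧
      j ^^^ (i ^^^ j ^^^ k ^^^ l) = i ^^^ k ^^^ l ∧ k ^^^ (i ^^^ j ^^^ k ^^^ l) = i ^^^ j ^^^ l ∧
      l ^^^ (i ^^^ j ^^^ k ^^^ l) = i ^^^ j ^^^ k := by
    decide +kernel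
  obtain ⟨h0, h1, h2, h3, h4⟩ := hs i j k l hd
  obtain ⟨x1, x2, x3, x4⟩ := hx i j k l
  generalize φ (j ^^^ k ^^^ l) j k l * W (j ^^^ k ^^^ l) i = c at h0 h1 h2 h3 h4
  refine ⟨c, by exact_mod_cast h0, fun A => ?_⟩
  simp only [hD, Φ₀_slot_zero, Φ₀_slot_one, Φ₀_slot_two, Φ₀_slot_three, signedEntry, ht,
    x1, x2, x3, x4, h1, h2, h3, h4]
  push_cast
  ring

theorem form_sum_apply {n : ℕ} {ι : Type*} (s : Finset ι) (f : ι → Form n) (v : Fin n → V) :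
    (∑ i ∈ s, f i) v = ∑ i ∈ s, f i v :=
  map_sum (⟨⟨fun β => β v, fun _ _ => rfl⟩, fun _ _ => rfl⟩ : Form n →ₗ[ℝ] ℝ) f s

theorem end_eq_zero {A : V →ₗ[ℝ] V} (h : ∀ i j, A (e j) i = 0) : A = 0 := by
  refine (Pi.basisFun ℝ (Fin 8)).ext fun j => ?_
  ext i
  rw [Pi.basisFun_apply]
  exact h i j

theorem toLin'_apply_e (a : Matrix (Fin 8) (Fin 8) ℝ) (i j : Fin 8) :
    Matrix.toLin' a (e j) i = a i j := by
  simp [e]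

theorem finrank_le_card_of_entries (T : Submodule ℝ (V →ₗ[ℝ] V)) (P : Fin 8 × Fin 8 → Prop)
    [DecidablePred P]
    (h : ∀ A ∈ T, (∀ p, P p → A (e p.2) p.1 = 0) → A = 0) :
    Module.finrank ℝ T ≤ Fintype.card {p // P p} := by
  let f : (V →ₗ[ℝ] V) →ₗ[ℝ] ({p // P p} → ℝ) :=
    { toFun := fun A p => A (e p.1.2) p.1.1
      map_add' := fun _ _ => rfl
      map_smul' := fun _ _ => rfl }
  have hf : Function.Injective (f.comp T.subtype) := by
    refine (injective_iff_map_eq_zero _).2 fun A hA => Subtype.ext (h A A.2 fun p hp => ?_)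
    exact congrFun hA ⟨p, hp⟩
  simpa using LinearMap.finrank_le_finrank_of_injective hf

/-- The endomorphisms of `ℝ⁸` whose skew part lies in `Λ²₇`. -/
def symPlusSeven : Submodule ℝ (V →ₗ[ℝ] V) where
  carrier := {A | ∀ i j, W i j * (A (e j) i - A (e i) j) =
    A (e (i ^^^ j)) 0 - A (e 0) (i ^^^ j)}
  add_mem' := by
    intro A B hA hB i j
    have := hA i j
    have := hB i j
    simp only [LinearMap.add_apply, Pi.add_apply]
    linarith
  zero_mem' := by
    intro i j
    simp
  smul_mem' := by
    intro c A hA i j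
    have := hA i j
    simp only [LinearMap.smul_apply, Pi.smul_apply, smul_eq_mul]
    linear_combination c * this

theorem mem_symPlusSeven {A : V →ₗ[ℝ] V} : A ∈ symPlusSeven ↔
    ∀ i j, W i j * (A (e j) i - A (e i) j) = A (e (i ^^^ j)) 0 - A (e 0) (i ^^^ j) := Iff.rfl

theorem dotProduct_e (x : V) (i : Fin 8) : x ⬝ᵥ e i = x i := by
  simp [e]

theorem e_dotProduct (x : V) (i : Fin 8) : e i ⬝ᵥ x = x i := by
  simp [e]

theorem fin_zero_xor (i : Fin 8) : 0 ^^^ i = i := by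
  revert i
  decide +kernel

theorem fin_xor_comm (i j : Fin 8) : i ^^^ j = j ^^^ i := by
  revert i j
  decide +kernel

theorem W_zero (i : Fin 8) : W 0 i = 1 := by
  revert i
  decide +kernel

theorem fun_e_eq (v : Fin 2 → Fin 8) : (fun a => e (v a)) = ![e (v 0), e (v 1)] := by
  ext a
  fin_cases a <;> rfl

theorem exists_sym_add_seven_iff {M : Form 2 →ₗ[ℝ] Form 2}
    (hM : ∀ α β : Form 2, wedge (wedge α β) Φ₀ = formInner (M α) β • vol₀) (A : V →ₗ[ℝ] V) :
    (∃ h X : V →ₗ[ℝ] V, A = h + X ∧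
      (∀ x y : V, h x ⬝ᵥ y = x ⬝ᵥ h y) ∧
      (∀ x y : V, X x ⬝ᵥ y = -(x ⬝ᵥ X y)) ∧
      ∃ α : Form 2, (∀ x y : V, α ![x, y] = X x ⬝ᵥ y) ∧ M α = (3 : ℝ) • α) ↔
    A ∈ symPlusSeven := by
  constructor
  · rintro ⟨h, X, rfl, hh, hX, α, hα, hMα⟩
    have hh' : ∀ i j, h (e i) j = h (e j) i := by
      intro i j
      simpa only [dotProduct_e, e_dotProduct] using hh (e i) (e j)
    have hX' : ∀ i j, X (e j) i = -X (e i) j := by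
      intro i j
      simpa only [dotProduct_e, e_dotProduct] using hX (e j) (e i)
    have key : ∀ {k l : Fin 8}, k < l → W k l * X (e k) l =
        1 / 8 * ∑ i, W i (i ^^^ (k ^^^ l)) * X (e i) (i ^^^ (k ^^^ l)) := by
      intro k l hkl
      have h1 := apply_e_of_wedge_eq hM α hkl
      simp only [hMα, AlternatingMap.smul_apply, hα, dotProduct_e, smul_eq_mul] at h1
      rw [sum_mul_φ (fun i j => X (e i) j) hX' hkl.ne] at h1
      have h2 := W_mul_self k l
      linear_combination (1 / 4 * W k l : ℝ) * h1 + (1 / 8 *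
        ∑ i, W i (i ^^^ (k ^^^ l)) * X (e i) (i ^^^ (k ^^^ l))) * h2
    rw [mem_symPlusSeven]
    intro i j
    obtain rfl | hij := eq_or_ne i j
    · simp
    have key' : ∀ {k l : Fin 8}, k ≠ l → W k l * X (e k) l =
        1 / 8 * ∑ i, W i (i ^^^ (k ^^^ l)) * X (e i) (i ^^^ (k ^^^ l)) := by
      intro k l hkl
      obtain hlt | hlt := hkl.lt_or_gt
      · exact key hlt
      · rw [W_swap hkl.symm, hX' l k, fin_xor_comm k l, ← key hlt]
        ring
    have h0 : (0 : Fin 8) ≠ i ^^^ j := by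
      have : ∀ i j : Fin 8, i ≠ j → 0 ≠ i ^^^ j := by decide +kernel
      exact this i j hij
    have h1 := key' hij
    have h2 := key' h0
    rw [fin_zero_xor, W_zero, ← h1] at h2
    simp only [LinearMap.add_apply, Pi.add_apply, hh' i j, hh' 0 (i ^^^ j), hX' i j,
      hX' 0 (i ^^^ j)]
    push_cast at h2
    linear_combination 2 * h2
  · intro hA
    let a : Matrix (Fin 8) (Fin 8) ℝ := LinearMap.toMatrix' A
    have ha : ∀ i j, a i j = A (e j) i := fun i j => by
      simp [a, LinearMap.toMatrix'_apply, e]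
    let X := Matrix.toLin' ((1 / 2 : ℝ) • (a - aᵀ))
    let α : Form 2 := (1 / 2 : ℝ) • ∑ i, ∑ j, (1 / 2 * (a j i - a i j)) • mon ![i, j]
    have hXx : ∀ x : V, X x = ((1 / 2 : ℝ) • (a - aᵀ)) *ᵥ x := fun x => rfl
    have hX : ∀ x y : V, X x ⬝ᵥ y = -(x ⬝ᵥ X y) := by
      intro x y
      rw [hXx, hXx, Matrix.dotProduct_mulVec, ← Matrix.mulVec_transpose, ← neg_dotProduct,
        ← Matrix.neg_mulVec]
      congr 2
      ext i j
      simp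
      ring
    have hα : ∀ x y : V, α ![x, y] = X x ⬝ᵥ y := by
      intro x y
      have h1 : ∑ i, ∑ j, 1 / 2 * (a j i - a i j) * (x j * y i) =
          -∑ i, ∑ j, 1 / 2 * (a j i - a i j) * (x i * y j) := by
        rw [Finset.sum_comm]
        simp only [← Finset.sum_neg_distrib]
        refine Finset.sum_congr rfl fun i _ => Finset.sum_congr rfl fun j _ => ?_
        ring
      have h2 : X x ⬝ᵥ y = ∑ i, ∑ j, 1 / 2 * (a j i - a i j) * (x i * y j) := by
        rw [hXx, dotProduct, Finset.sum_comm]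
        refine Finset.sum_congr rfl fun j _ => ?_
        rw [mulVec, dotProduct, Finset.sum_mul]
        refine Finset.sum_congr rfl fun i _ => ?_
        simp
        ring
      have h3 : α ![x, y] = 1 / 2 * ((∑ i, ∑ j, 1 / 2 * (a j i - a i j) * (x i * y j)) -
          ∑ i, ∑ j, 1 / 2 * (a j i - a i j) * (x j * y i)) := by
        simp only [α, AlternatingMap.smul_apply, form_sum_apply, mon_two, smul_eq_mul,
          mul_sub (_ * _), Finset.sum_sub_distrib]
      rw [h3, h2, h1]
      ring
    refine ⟨Matrix.toLin' ((1 / 2 : ℝ) • (a + aᵀ)), X, ?_, ?_, hX, α, hα, ?_⟩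
    · rw [← map_add, ← smul_add, ← Matrix.toLin'_toMatrix' A]
      congr 1
      ext i j
      simp [a]
      ring
    · intro x y
      rw [Matrix.toLin'_apply, Matrix.toLin'_apply, Matrix.dotProduct_mulVec,
        ← Matrix.mulVec_transpose]
      congr 2
      ext i j
      simp
      ring
    · refine form_ext fun v hv => ?_
      have hkl : v 0 < v 1 := hv (by decide)
      rw [fun_e_eq, apply_e_of_wedge_eq hM α hkl]
      have hX' : ∀ i j, X (e j) i = -X (e i) j := by
        intro i j
        simpa only [dotProduct_e, e_dotProduct] using hX (e j) (e i)
      have hXA : ∀ i j, X (e i) j = 1 / 2 * (A (e i) j - A (e j) i) := by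
        intro i j
        simp only [X, toLin'_apply_e, ← ha]
        simp
      generalize v 0 = k at hkl
      generalize v 1 = l at hkl
      simp only [AlternatingMap.smul_apply, hα, dotProduct_e, smul_eq_mul]
      rw [sum_mul_φ (fun i j => X (e i) j) hX' hkl.ne]
      have h1 : ∀ i, W i (i ^^^ (k ^^^ l)) * X (e i) (i ^^^ (k ^^^ l)) = W k l * X (e k) l := by
        intro i
        have h1 := mem_symPlusSeven.1 hA k l
        have h2 := mem_symPlusSeven.1 hA i (i ^^^ (k ^^^ l))
        rw [xor_xor_left, ← h1] at h2
        rw [hXA, hXA]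
        linear_combination (-1 / 2 : ℝ) * h2
      simp only [h1]
      have h2 := W_mul_self k l
      simp
      linear_combination (4 * X (e k) l) * h2

theorem sum_signedEntry_eq_zero {D : (V →ₗ[ℝ] V) →ₗ[ℝ] Form 4}
    (hD : ∀ (A : V →ₗ[ℝ] V) (x y z w : V),
      D A ![x, y, z, w] =
        Φ₀ ![A x, y, z, w] + Φ₀ ![x, A y, z, w] + Φ₀ ![x, y, A z, w] + Φ₀ ![x, y, z, A w])
    {A : V →ₗ[ℝ] V} (hA : D A = 0) {t i j k l : Fin 8} (hd : [i, j, k, l].Nodup)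
    (ht : t = i ^^^ j ^^^ k ^^^ l) :
    signedEntry A t i + signedEntry A t j + signedEntry A t k + signedEntry A t l = 0 := by
  obtain ⟨c, hc, h⟩ := exists_sign_mul_sum hD hd ht
  have := h A
  rw [hA, AlternatingMap.zero_apply] at this
  exact (mul_eq_zero.1 this.symm).resolve_left hc

theorem signedEntry_xor {D : (V →ₗ[ℝ] V) →ₗ[ℝ] Form 4}
    (hD : ∀ (A : V →ₗ[ℝ] V) (x y z w : V),
      D A ![x, y, z, w] =
        Φ₀ ![A x, y, z, w] + Φ₀ ![x, A y, z, w] + Φ₀ ![x, y, A z, w] + Φ₀ ![x, y, z, A w])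
    {A : V →ₗ[ℝ] V} (hA : D A = 0) {t : Fin 8} (ht : t ≠ 0) (i : Fin 8) :
    signedEntry A t i = signedEntry A t (i ^^^ t) := by
  have h : ∀ t i : Fin 8, t ≠ 0 → ∃ j k l : Fin 8,
      ([i, j, k, l].Nodup ∧ t = i ^^^ j ^^^ k ^^^ l) ∧
      ([i, j ^^^ t, k ^^^ t, l].Nodup ∧ t = i ^^^ (j ^^^ t) ^^^ (k ^^^ t) ^^^ l) ∧
      ([i ^^^ t, j ^^^ t, k, l].Nodup ∧ t = (i ^^^ t) ^^^ (j ^^^ t) ^^^ k ^^^ l) ∧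
      ([i ^^^ t, j, k ^^^ t, l].Nodup ∧ t = (i ^^^ t) ^^^ j ^^^ (k ^^^ t) ^^^ l) := by
    decide +kernel
  obtain ⟨j, k, l, ⟨h1, h1'⟩, ⟨h2, h2'⟩, ⟨h3, h3'⟩, h4, h4'⟩ := h t i ht
  have e1 := sum_signedEntry_eq_zero hD hA h1 h1'
  have e2 := sum_signedEntry_eq_zero hD hA h2 h2'
  have e3 := sum_signedEntry_eq_zero hD hA h3 h3'
  have e4 := sum_signedEntry_eq_zero hD hA h4 h4'
  linarith

theorem entry_swap {D : (V →ₗ[ℝ] V) →ₗ[ℝ] Form 4}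
    (hD : ∀ (A : V →ₗ[ℝ] V) (x y z w : V),
      D A ![x, y, z, w] =
        Φ₀ ![A x, y, z, w] + Φ₀ ![x, A y, z, w] + Φ₀ ![x, y, A z, w] + Φ₀ ![x, y, z, A w])
    {A : V →ₗ[ℝ] V} (hA : D A = 0) {i j : Fin 8} (hij : i ≠ j) :
    A (e j) i = -A (e i) j := by
  have hx : ∀ i j : Fin 8, i ≠ j →
      i ^^^ j ≠ 0 ∧ i ^^^ (i ^^^ j) = j ∧ j ^^^ (i ^^^ j) = i := by
    decide +kernel
  obtain ⟨h1, h2, h3⟩ := hx i j hij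
  have h := signedEntry_xor hD hA h1 i
  rw [signedEntry, signedEntry, h2, h3, W_swap hij] at h
  have h4 := W_mul_self i j
  linear_combination (-W i j : ℝ) * h - (A (e i) j + A (e j) i) * h4

theorem entry_self {D : (V →ₗ[ℝ] V) →ₗ[ℝ] Form 4}
    (hD : ∀ (A : V →ₗ[ℝ] V) (x y z w : V),
      D A ![x, y, z, w] =
        Φ₀ ![A x, y, z, w] + Φ₀ ![x, A y, z, w] + Φ₀ ![x, y, A z, w] + Φ₀ ![x, y, z, A w])
    {A : V →ₗ[ℝ] V} (hA : D A = 0) (i : Fin 8) : A (e i) i = 0 := by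
  have h0 : ∀ i, signedEntry A 0 i = A (e i) i := by
    intro i
    have h : ∀ i : Fin 8, i ^^^ 0 = i ∧ W i i = 1 := by decide +kernel
    rw [signedEntry, (h i).1, (h i).2]
    simp
  have hq : ∀ i j k l : Fin 8, [i, j, k, l].Nodup ∧ 0 = i ^^^ j ^^^ k ^^^ l →
      A (e i) i + A (e j) j + A (e k) k + A (e l) l = 0 := by
    intro i j k l h
    simpa only [h0] using sum_signedEntry_eq_zero hD hA h.1 h.2
  have q1 := hq 0 1 2 3 (by decide)
  have q2 := hq 0 1 4 5 (by decide)
  have q3 := hq 0 1 6 7 (by decide)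
  have q4 := hq 0 2 4 6 (by decide)
  have q5 := hq 0 2 5 7 (by decide)
  have q6 := hq 0 3 4 7 (by decide)
  have q7 := hq 0 3 5 6 (by decide)
  have q8 := hq 4 5 6 7 (by decide)
  have q9 := hq 2 3 6 7 (by decide)
  have q10 := hq 2 3 4 5 (by decide)
  have q11 := hq 1 3 5 7 (by decide)
  have q12 := hq 1 3 4 6 (by decide)
  have q13 := hq 1 2 5 6 (by decide)
  have q14 := hq 1 2 4 7 (by decide)
  fin_cases i <;> simp only [Fin.reduceFinMk, Fin.zero_eta, Fin.mk_one] <;> linarith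

theorem eq_zero_of_mem_ker {D : (V →ₗ[ℝ] V) →ₗ[ℝ] Form 4}
    (hD : ∀ (A : V →ₗ[ℝ] V) (x y z w : V),
      D A ![x, y, z, w] =
        Φ₀ ![A x, y, z, w] + Φ₀ ![x, A y, z, w] + Φ₀ ![x, y, A z, w] + Φ₀ ![x, y, z, A w])
    {A : V →ₗ[ℝ] V} (hA : D A = 0) (h : ∀ i j : Fin 8, j < i → j ≠ 0 → A (e j) i = 0) :
    A = 0 := by
  have h1 : ∀ i j : Fin 8, i ≠ 0 → j ≠ 0 → A (e j) i = 0 := by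
    intro i j hi hj
    obtain hij | rfl | hij := lt_trichotomy i j
    · rw [entry_swap hD hA hij.ne, h j i hij hi, neg_zero]
    · exact entry_self hD hA i
    · exact h i j hij hj
  have h2 : ∀ t : Fin 8, t ≠ 0 → A (e 0) t = 0 := by
    intro t ht
    have hx : ∀ t : Fin 8, t ≠ 0 → W t 0 = -1 ∧ ∃ j k l : Fin 8,
        ([0, j, k, l].Nodup ∧ t = 0 ^^^ j ^^^ k ^^^ l) ∧ (j ^^^ t ≠ 0 ∧ j ≠ 0) ∧
        (k ^^^ t ≠ 0 ∧ k ≠ 0) ∧ (l ^^^ t ≠ 0 ∧ l ≠ 0) := by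
      decide +kernel
    obtain ⟨hW, j, k, l, ⟨hd, hs⟩, ⟨hj, hj'⟩, ⟨hk, hk'⟩, hl, hl'⟩ := hx t ht
    have := sum_signedEntry_eq_zero hD hA hd hs
    simp only [signedEntry, fin_zero_xor, h1 _ _ hj hj', h1 _ _ hk hk', h1 _ _ hl hl', hW] at this
    push_cast at this
    linarith
  refine end_eq_zero fun i j => ?_
  obtain rfl | hj := eq_or_ne j 0
  · obtain rfl | hi := eq_or_ne i 0
    · exact entry_self hD hA 0
    · exact h2 i hi
  · obtain rfl | hi := eq_or_ne i 0
    · rw [entry_swap hD hA hj.symm, h2 j hj, neg_zero]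
    · exact h1 i j hi hj

theorem eq_zero_of_mem_symPlusSeven {A : V →ₗ[ℝ] V} (hA : A ∈ symPlusSeven)
    (h : ∀ i j : Fin 8, i ≤ j ∨ j = 0 → A (e j) i = 0) : A = 0 := by
  refine end_eq_zero fun i j => ?_
  obtain hij | hij := le_or_gt i j
  · exact h i j (Or.inl hij)
  · have h1 := mem_symPlusSeven.1 hA i j
    rw [h j i (Or.inl hij.le), h 0 _ (Or.inl (Fin.zero_le _)), h _ 0 (Or.inr rfl)] at h1
    have h2 := W_mul_self i j
    linear_combination (W i j : ℝ) * h1 - A (e j) i * h2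

theorem map_eq_zero_of_skew {D : (V →ₗ[ℝ] V) →ₗ[ℝ] Form 4}
    (hD : ∀ (A : V →ₗ[ℝ] V) (x y z w : V),
      D A ![x, y, z, w] =
        Φ₀ ![A x, y, z, w] + Φ₀ ![x, A y, z, w] + Φ₀ ![x, y, A z, w] + Φ₀ ![x, y, z, A w])
    {A : V →ₗ[ℝ] V} (hA : ∀ i j, A (e j) i = -A (e i) j)
    (h : ∀ t, ∑ i, signedEntry A t i = 0) : D A = 0 := by
  refine form_ext fun v hv => ?_
  have hv4 : (fun a => e (v a)) = ![e (v 0), e (v 1), e (v 2), e (v 3)] := by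
    ext a
    fin_cases a <;> rfl
  have hd : [v 0, v 1, v 2, v 3].Nodup := by
    simp [hv.injective.eq_iff]
  rw [hv4, AlternatingMap.zero_apply]
  generalize v 0 = i at hd
  generalize v 1 = j at hd
  generalize v 2 = k at hd
  generalize v 3 = l at hd
  obtain ⟨c, -, hc⟩ := exists_sign_mul_sum hD hd rfl
  rw [hc]
  by_cases ht : i ^^^ j ^^^ k ^^^ l = 0
  · have h0 : ∀ i, signedEntry A 0 i = 0 := by
      intro i
      have h1 : i ^^^ 0 = i := by
        revert i
        decide +kernel
      rw [signedEntry, h1]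
      linear_combination (W i i / 2 : ℝ) * hA i i
    simp [ht, h0]
  · have hinj : ∀ i j k l : Fin 8, [i, j, k, l].Nodup → i ^^^ j ^^^ k ^^^ l ≠ 0 →
        Function.Injective ![i, j, k, l, j ^^^ k ^^^ l, i ^^^ k ^^^ l, i ^^^ j ^^^ l,
          i ^^^ j ^^^ k] := by
      decide +kernel
    have hb := Finite.injective_iff_bijective.1 (hinj i j k l hd ht)
    have hs := h (i ^^^ j ^^^ k ^^^ l)
    rw [← (Equiv.ofBijective _ hb).sum_comp] at hs
    simp only [Equiv.ofBijective_apply, Fin.sum_univ_eight] at hs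
    have hx : ∀ t i : Fin 8, t ≠ 0 → signedEntry A t (i ^^^ t) = signedEntry A t i := by
      intro t i ht
      have : ∀ t i : Fin 8, t ≠ 0 → i ^^^ t ^^^ t = i ∧ i ≠ i ^^^ t := by decide +kernel
      obtain ⟨h1, h2⟩ := this t i ht
      rw [signedEntry, signedEntry, h1, hA, W_swap h2]
      ring
    have hx4 : ∀ i j k l : Fin 8, j ^^^ k ^^^ l = i ^^^ (i ^^^ j ^^^ k ^^^ l) ∧
        i ^^^ k ^^^ l = j ^^^ (i ^^^ j ^^^ k ^^^ l) ∧
        i ^^^ j ^^^ l = k ^^^ (i ^^^ j ^^^ k ^^^ l) ∧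
        i ^^^ j ^^^ k = l ^^^ (i ^^^ j ^^^ k ^^^ l) := by
      decide +kernel
    obtain ⟨x1, x2, x3, x4⟩ := hx4 i j k l
    have y1 := hx _ i ht
    have y2 := hx _ j ht
    have y3 := hx _ k ht
    have y4 := hx _ l ht
    rw [← x1] at y1
    rw [← x2] at y2
    rw [← x3] at y3
    rw [← x4] at y4
    simp only [Matrix.cons_val] at hs
    rw [y1, y2, y3, y4] at hs
    linear_combination (c / 2) * hs

theorem symPlusSeven_sup_ker {D : (V →ₗ[ℝ] V) →ₗ[ℝ] Form 4}
    (hD : ∀ (A : V →ₗ[ℝ] V) (x y z w : V),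
      D A ![x, y, z, w] =
        Φ₀ ![A x, y, z, w] + Φ₀ ![x, A y, z, w] + Φ₀ ![x, y, A z, w] + Φ₀ ![x, y, z, A w]) :
    symPlusSeven ⊔ LinearMap.ker D = ⊤ := by
  refine eq_top_iff.2 fun A _ => ?_
  let s : Fin 8 → Fin 8 → ℝ := fun i j => 1 / 2 * (A (e j) i - A (e i) j)
  have hs : ∀ i j, s i j = 1 / 2 * (A (e j) i - A (e i) j) := fun _ _ => rfl
  have hs' : ∀ i j, s j i = -s i j := by
    intro i j
    rw [hs, hs]
    ring
  let c : Fin 8 → ℝ := fun t => 1 / 8 * ∑ i, W (i ^^^ t) i * s (i ^^^ t) i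
  have hc : ∀ t, c t = 1 / 8 * ∑ i, W (i ^^^ t) i * s (i ^^^ t) i := fun _ => rfl
  have hc0 : c 0 = 0 := by
    have h1 : ∀ i : Fin 8, i ^^^ 0 = i := by decide +kernel
    simp [hc, h1, hs]
  have hx : ∀ i : Fin 8, i ^^^ i = 0 := by decide +kernel
  have hws : ∀ i j, W j i * c (j ^^^ i) = -(W i j * c (i ^^^ j)) := by
    intro i j
    obtain rfl | hij := eq_or_ne i j
    · simp [hx, hc0]
    · rw [W_swap hij, fin_xor_comm j i]
      ring
  let B : V →ₗ[ℝ] V := Matrix.toLin' (Matrix.of fun i j => s i j - W i j * c (i ^^^ j))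
  have hB : ∀ i j, B (e j) i = s i j - W i j * c (i ^^^ j) := by
    intro i j
    simp only [B, toLin'_apply_e, Matrix.of_apply]
  have hB' : ∀ i j, B (e j) i = -B (e i) j := by
    intro i j
    rw [hB, hB, hws, hs']
    ring
  refine Submodule.mem_sup.2 ⟨A - B, ?_, B, ?_, sub_add_cancel A B⟩
  · rw [mem_symPlusSeven]
    intro i j
    have h0 : ∀ i j, (A - B) (e j) i - (A - B) (e i) j = 2 * (W i j * c (i ^^^ j)) := by
      intro i j
      simp only [LinearMap.sub_apply, Pi.sub_apply]
      rw [hB i j, hB j i, hs i j, hs j i, hws i j]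
      ring
    have h1 := h0 0 (i ^^^ j)
    rw [fin_zero_xor, W_zero] at h1
    rw [h0, h1]
    have h2 := W_mul_self i j
    push_cast
    linear_combination (2 * c (i ^^^ j)) * h2
  · refine LinearMap.mem_ker.2 (map_eq_zero_of_skew hD hB' fun t => ?_)
    have h1 : ∀ i, signedEntry B t i = W (i ^^^ t) i * s (i ^^^ t) i - c t := by
      intro i
      have h2 : ∀ i t : Fin 8, i ^^^ t ^^^ i = t := by decide +kernel
      have h3 := W_mul_self (i ^^^ t) i
      rw [signedEntry, hB, h2]
      linear_combination (-c t) * h3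
    simp only [h1, Finset.sum_sub_distrib]
    rw [hc]
    simp

/-- **Injectivity of `A ↦ A⋄Φ₀` on `S² ⊕ Λ²₇` (Corollary 2.11):** the map `A ↦ A⋄Φ₀` is
injective on the 43-dimensional subspace of endomorphisms of `ℝ⁸` of the form `h + X`,
where `h` is self-adjoint and `X` is skew-adjoint with associated 2-form
`α_X(x,y) = ⟨Xx, y⟩` lying in `Λ²₇ = ker(M − 3·id)`; consequently the image of
`A ↦ A⋄Φ₀` is a 43-dimensional subspace of the alternating 4-forms on `ℝ⁸`. -/
theorem diamond_injective (M : Form 2 →ₗ[ℝ] Form 2)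
    (hM : ∀ α β : Form 2, wedge (wedge α β) Φ₀ = formInner (M α) β • vol₀)
    (D : (V →ₗ[ℝ] V) →ₗ[ℝ] Form 4)
    (hD : ∀ (A : V →ₗ[ℝ] V) (x y z w : V),
      D A ![x, y, z, w] =
        Φ₀ ![A x, y, z, w] + Φ₀ ![x, A y, z, w] + Φ₀ ![x, y, A z, w] + Φ₀ ![x, y, z, A w]) :
    (∀ S : Submodule ℝ (V →ₗ[ℝ] V),
      (↑S = {A : V →ₗ[ℝ] V | ∃ h X : V →ₗ[ℝ] V, A = h + X ∧
          (∀ x y : V, h x ⬝ᵥ y = x ⬝ᵥ h y) ∧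
          (∀ x y : V, X x ⬝ᵥ y = -(x ⬝ᵥ X y)) ∧
          ∃ α : Form 2, (∀ x y : V, α ![x, y] = X x ⬝ᵥ y) ∧ M α = (3 : ℝ) • α}) →
        Module.finrank ℝ S = 43) ∧
    Set.InjOn D {A : V →ₗ[ℝ] V | ∃ h X : V →ₗ[ℝ] V, A = h + X ∧
      (∀ x y : V, h x ⬝ᵥ y = x ⬝ᵥ h y) ∧
      (∀ x y : V, X x ⬝ᵥ y = -(x ⬝ᵥ X y)) ∧
      ∃ α : Form 2, (∀ x y : V, α ![x, y] = X x ⬝ᵥ y) ∧ M α = (3 : ℝ) • α} ∧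
    Module.finrank ℝ (LinearMap.range D) = 43 := by
  have hset : {A : V →ₗ[ℝ] V | ∃ h X : V →ₗ[ℝ] V, A = h + X ∧
      (∀ x y : V, h x ⬝ᵥ y = x ⬝ᵥ h y) ∧
      (∀ x y : V, X x ⬝ᵥ y = -(x ⬝ᵥ X y)) ∧
      ∃ α : Form 2, (∀ x y : V, α ![x, y] = X x ⬝ᵥ y) ∧ M α = (3 : ℝ) • α} = symPlusSeven :=
    Set.ext fun A => exists_sym_add_seven_iff hM A
  have h43 : Module.finrank ℝ symPlusSeven ≤ 43 :=
    finrank_le_card_of_entries _ (fun p => p.1 ≤ p.2 ∨ p.2 = 0)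
      fun A hA h => eq_zero_of_mem_symPlusSeven hA fun i j hij => h (i, j) hij
  have h21 : Module.finrank ℝ (LinearMap.ker D) ≤ 21 :=
    finrank_le_card_of_entries _ (fun p => p.2 < p.1 ∧ p.2 ≠ 0)
      fun A hA h => eq_zero_of_mem_ker hD hA fun i j hij hj => h (i, j) ⟨hij, hj⟩
  have h64 : Module.finrank ℝ (V →ₗ[ℝ] V) = 64 := by
    simp [Module.finrank_linearMap]
  have hsum := Submodule.finrank_sup_add_finrank_inf_eq symPlusSeven (LinearMap.ker D)
  rw [symPlusSeven_sup_ker hD, finrank_top, h64] at hsum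
  have hrank := LinearMap.finrank_range_add_finrank_ker D
  rw [h64] at hrank
  have hbot : symPlusSeven ⊓ LinearMap.ker D = ⊥ := Submodule.finrank_eq_zero.1 (by omega)
  rw [hset]
  refine ⟨fun S hS => ?_, ?_, by omega⟩
  · rw [SetLike.coe_injective hS]
    omega
  · exact LinearMap.injOn_of_disjoint_ker le_rfl (disjoint_iff.2 hbot)

end
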